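/- Pointwise convergence of the characteristic functions to a Gaussian: fix ρ ∈ ℝ^m and set μ := ∇φ(ρ), H := Hess φ(ρ). Assume (i) hypothesis (QQ) on every compact subset of P°; (ii) the density-of-states expansion Π_k(ρ) = k^m(1 + O(1/k)); and (iii) localization at ρ: for every δ > 0, Π_k(ρ)^{-1} Σ_{α ∈ kP∩ℤ^m, |α/k − μ| ≥ δ} w_{k,α}(ρ) → 0 as k → ∞. Then for every t ∈ ℝ^m, Π_k(ρ)^{-1} Σ_{α ∈ kP∩ℤ^m} w_{k,α}(ρ) e^{ i ⟨ t, √k(α/k − μ) ⟩ } → e^{ −(1/2) ⟨ H t, t ⟩ } as k → ∞; that is, the characteristic function of the centered, √k-dilated measure D_{√k} μ̃_k^ρ converges pointwise to the characteristic function of the centered Gaussian with covariance H. -/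

import Mathlib

open MeasureTheory Real Filter
open scoped BigOperators Topology Classical ENNReal

noncomputable section

/-- Euclidean dot product on `ℝ^m`. -/
def dotp {m : ℕ} (x y : Fin m → ℝ) : ℝ := ∑ i, x i * y i

/-- Euclidean norm on `ℝ^m`. -/
def enorm' {m : ℕ} (x : Fin m → ℝ) : ℝ := Real.sqrt (∑ i, x i ^ 2)

/-- Partial derivative `∂f/∂ρ_j`. -/
def pd {m : ℕ} (f : (Fin m → ℝ) → ℝ) (j : Fin m) (ρ : Fin m → ℝ) : ℝ :=
  fderiv ℝ f ρ (Pi.single j 1)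

/-- Hessian matrix `(∂²f/∂ρ_i∂ρ_j)`. -/
def hess {m : ℕ} (f : (Fin m → ℝ) → ℝ) (ρ : Fin m → ℝ) : Matrix (Fin m) (Fin m) ℝ :=
  Matrix.of fun i j => pd (fun ρ' => pd f j ρ') i ρ

/-- Gradient map `∇f : ℝ^m → ℝ^m`. -/
def gradMap {m : ℕ} (f : (Fin m → ℝ) → ℝ) (ρ : Fin m → ℝ) : Fin m → ℝ :=
  fun i => pd f i ρ

/-- The rescaled lattice point `α/k ∈ ℝ^m`. -/
def lpt {m : ℕ} (k : ℕ) (α : Fin m → ℤ) : Fin m → ℝ := fun i => (α i : ℝ) / k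

/-- The norming constant `Q_k(α) = ∫ e^{⟨α,ρ⟩ - kφ(ρ)} det(Hess φ(ρ)) dρ`. -/
def Qk {m : ℕ} (φ : (Fin m → ℝ) → ℝ) (k : ℕ) (α : Fin m → ℤ) : ℝ :=
  ∫ ρ : Fin m → ℝ, Real.exp (dotp (fun i => (α i : ℝ)) ρ - k * φ ρ) * (hess φ ρ).det

/-- The Bergman weight `w_{k,α}(ρ) = e^{⟨α,ρ⟩ - kφ(ρ)}/Q_k(α)` for `α ∈ kP ∩ ℤ^m`. -/
def wt {m : ℕ} (P : Set (Fin m → ℝ)) (φ : (Fin m → ℝ) → ℝ) (k : ℕ) (α : Fin m → ℤ)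
    (ρ : Fin m → ℝ) : ℝ :=
  if lpt k α ∈ P then Real.exp (dotp (fun i => (α i : ℝ)) ρ - k * φ ρ) / Qk φ k α else 0

/-- The Bergman density of states `Π_k(ρ) = Σ_{α ∈ kP∩ℤ^m} w_{k,α}(ρ)`. -/
def dos {m : ℕ} (P : Set (Fin m → ℝ)) (φ : (Fin m → ℝ) → ℝ) (k : ℕ) (ρ : Fin m → ℝ) : ℝ :=
  ∑' α : Fin m → ℤ, wt P φ k α ρ

/-- The inverse `ρ(·)` of the moment map `∇φ`. -/
def legInv {m : ℕ} (φ : (Fin m → ℝ) → ℝ) : (Fin m → ℝ) → (Fin m → ℝ) :=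
  Function.invFun (gradMap φ)

/-- The symplectic potential (Legendre transform) `u(x) = ⟨x, ρ(x)⟩ - φ(ρ(x))`. -/
def sympPot {m : ℕ} (φ : (Fin m → ℝ) → ℝ) (x : Fin m → ℝ) : ℝ :=
  dotp x (legInv φ x) - φ (legInv φ x)

theorem dotp_comm {m : ℕ} (x y : Fin m → ℝ) : dotp x y = dotp y x :=
  Finset.sum_congr rfl fun _ _ => mul_comm _ _

/-- The Euclidean dot product as a continuous bilinear map. -/
def dotCLM {m : ℕ} : (Fin m → ℝ) →L[ℝ] (Fin m → ℝ) →L[ℝ] ℝ :=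
  ∑ i, (ContinuousLinearMap.proj i : (Fin m → ℝ) →L[ℝ] ℝ).smulRight
    (ContinuousLinearMap.proj i : (Fin m → ℝ) →L[ℝ] ℝ)

theorem dotCLM_apply {m : ℕ} (x y : Fin m → ℝ) : dotCLM x y = dotp x y := by
  simp [dotCLM, dotp]

theorem integral_floor_eq_tsum {m : ℕ} {s : ℝ} (hs : 0 < s) (b : Fin m → ℝ)
    (g : (Fin m → ℤ) → ℂ) (hg : g.support.Finite) :
    ∫ y : Fin m → ℝ, g (fun i => ⌊s * y i + b i⌋) = ((s : ℂ) ^ m)⁻¹ * ∑' α, g α := by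
  set T : (Fin m → ℝ) → (Fin m → ℤ) := fun y i => ⌊s * y i + b i⌋ with hT
  have hTm : Measurable T := by
    refine measurable_pi_lambda _ fun i => Int.measurable_floor.comp ?_
    fun_prop
  have hpre : ∀ α, T ⁻¹' {α} =
      Set.univ.pi fun i => Set.Ico (((α i : ℝ) - b i) / s) (((α i : ℝ) + 1 - b i) / s) := by
    intro α
    ext y
    simp only [Set.mem_preimage, Set.mem_singleton_iff, funext_iff, hT, Int.floor_eq_iff,
      Set.mem_pi, Set.mem_univ, true_imp_iff, Set.mem_Ico, div_le_iff₀ hs, lt_div_iff₀ hs]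
    refine forall_congr' fun i => ?_
    constructor <;> rintro ⟨h1, h2⟩ <;> constructor <;> linarith
  have hvol : ∀ α, (volume.map T) {α} = ENNReal.ofReal ((s ^ m)⁻¹) := by
    intro α
    rw [Measure.map_apply hTm (measurableSet_singleton α), hpre, Real.volume_pi_Ico,
      ← ENNReal.ofReal_prod_of_nonneg]
    · congr 1
      rw [Finset.prod_congr rfl (g := fun _ => s⁻¹) fun i _ => by field_simp; ring]
      simp
    · intro i _
      rw [← sub_div]
      exact div_nonneg (by linarith) hs.le
  have hint : Integrable g (volume.map T) := by
    have h1 : IntegrableOn g g.support (volume.map T) := by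
      rw [← Set.biUnion_of_singleton g.support, integrableOn_finite_biUnion hg]
      exact fun x _ => integrableOn_singleton (by simp) (by rw [hvol]; exact ENNReal.ofReal_lt_top)
    exact h1.integrable_of_forall_notMem_eq_zero fun x hx => by simpa using hx
  rw [← integral_map (φ := T) hTm.aemeasurable hint.aestronglyMeasurable, integral_countable hint,
    ← tsum_mul_left]
  refine tsum_congr fun α => ?_
  rw [Measure.real, hvol, ENNReal.toReal_ofReal (by positivity)]
  simp [Complex.real_smul]

open Matrix in
theorem dotp_eq_dotProduct {m : ℕ} (x y : Fin m → ℝ) : dotp x y = x ⬝ᵥ y := rfl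

theorem exists_quadratic_factorization {m : ℕ} {H : Matrix (Fin m) (Fin m) ℝ} (hH : H.PosDef) :
    ∃ B : Matrix (Fin m) (Fin m) ℝ, B.det ≠ 0 ∧ H⁻¹ = B.transpose * B := by
  have h := hH.inv
  open scoped MatrixOrder in
  obtain ⟨B, hB⟩ := CStarAlgebra.nonneg_iff_eq_star_mul_self.mp h.posSemidef.nonneg
  have hB' : H⁻¹ = B.transpose * B := by
    simpa [Matrix.star_eq_conjTranspose] using hB
  refine ⟨B, fun h0 => h.det_pos.ne' ?_, hB'⟩
  rw [hB', Matrix.det_mul, h0, mul_zero]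

theorem integral_gaussian_quadratic {m : ℕ} {H : Matrix (Fin m) (Fin m) ℝ} (hH : H.PosDef)
    (t : Fin m → ℝ) :
    ∫ y : Fin m → ℝ, (((2 * π) ^ (-(m : ℝ) / 2) * Real.sqrt (H.det)⁻¹ *
        Real.exp (-(1 / 2 * dotp (H⁻¹.mulVec y) y)) : ℝ) : ℂ) *
          Complex.exp (Complex.I * (dotp t y : ℝ)) =
      (Real.exp (-(1 / 2) * dotp (H.mulVec t) t) : ℝ) := by
  obtain ⟨B, hB, hHB⟩ := exists_quadratic_factorization hH
  have hu : IsUnit B.det := isUnit_iff_ne_zero.2 hB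
  have hHinv : H = B⁻¹ * B⁻¹.transpose := by
    have : H = (H⁻¹)⁻¹ := (Matrix.nonsing_inv_nonsing_inv H hH.det_pos.ne'.isUnit).symm
    rw [this, hHB, Matrix.mul_inv_rev, Matrix.transpose_nonsing_inv]
  set c : Fin m → ℝ := B⁻¹.transpose.mulVec t with hc
  have hq : ∀ y, dotp (H⁻¹.mulVec y) y = ∑ i, (B.mulVec y) i ^ 2 := by
    intro y
    rw [dotp_eq_dotProduct, hHB, ← Matrix.mulVec_mulVec, Matrix.mulVec_transpose,
      ← Matrix.dotProduct_mulVec]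
    simp [dotProduct, sq]
  have ht : ∀ y, dotp t y = dotp c (B.mulVec y) := by
    intro y
    rw [dotp_eq_dotProduct, dotp_eq_dotProduct, hc, Matrix.mulVec_transpose,
      ← Matrix.dotProduct_mulVec, Matrix.mulVec_mulVec, Matrix.nonsing_inv_mul _ hu,
      Matrix.one_mulVec]
  have hHt : dotp (H.mulVec t) t = ∑ i, c i ^ 2 := by
    rw [dotp_eq_dotProduct, hHinv, ← Matrix.mulVec_mulVec, ← hc, dotProduct_comm,
      Matrix.dotProduct_mulVec, ← Matrix.mulVec_transpose, ← hc]
    simp [dotProduct, sq]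
  have hdet : Real.sqrt (H.det)⁻¹ = |B.det| := by
    have : (H.det)⁻¹ = B.det ^ 2 := by
      rw [hHinv, Matrix.det_mul, Matrix.det_transpose, Matrix.det_nonsing_inv]
      simp [sq]
    rw [this, Real.sqrt_sq_eq_abs]
  set f : (Fin m → ℝ) → ℂ := fun v =>
    Complex.exp (-(1 / 2 : ℂ) * ∑ i, (v i : ℂ) ^ 2 + ∑ i, (Complex.I * c i) * v i) with hf
  have hchange : ∫ y, f (B.mulVec y) = ((|B.det| : ℝ) : ℂ)⁻¹ * ∫ v, f v := by
    have h1 := Real.map_matrix_volume_pi_eq_smul_volume_pi hB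
    have h2 : ∫ v, f v ∂(Measure.map (Matrix.toLin' B) volume) = ∫ y, f (B.mulVec y) := by
      rw [integral_map]
      · simp
      · exact (LinearMap.continuous_of_finiteDimensional _).aemeasurable
      · refine Continuous.aestronglyMeasurable ?_
        fun_prop
    rw [← h2, h1, integral_smul_measure, ENNReal.toReal_ofReal (abs_nonneg _), abs_inv,
      Complex.real_smul]
    simp
  have hval : ∫ v, f v = ((2 * π : ℝ) : ℂ) ^ ((m : ℂ) / 2) *
      (Real.exp (-(1 / 2) * dotp (H.mulVec t) t) : ℝ) := by
    rw [hf, GaussianFourier.integral_cexp_neg_mul_sum_add (by norm_num)]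
    rw [hHt]
    congr 1
    · simp; congr 1; ring
    · push_cast
      congr 1
      simp only [mul_pow, Complex.I_sq, ← Finset.mul_sum]
      ring
  have hpt : ∀ y, (((2 * π) ^ (-(m : ℝ) / 2) * Real.sqrt (H.det)⁻¹ *
        Real.exp (-(1 / 2 * dotp (H⁻¹.mulVec y) y)) : ℝ) : ℂ) *
          Complex.exp (Complex.I * (dotp t y : ℝ)) =
      (((2 * π) ^ (-(m : ℝ) / 2) * |B.det| : ℝ) : ℂ) * f (B.mulVec y) := by
    intro y
    rw [hdet, hq, ht, hf]
    simp only [dotp]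
    push_cast
    rw [Complex.exp_add]
    simp only [neg_mul]
    simp only [Finset.mul_sum, mul_assoc]
  simp_rw [hpt]
  rw [integral_const_mul, hchange, hval]
  have h1 : ((|B.det| : ℝ) : ℂ) ≠ 0 := by exact_mod_cast (abs_pos.2 hB).ne'
  have h2 : (((2 * π) ^ (-(m : ℝ) / 2) : ℝ) : ℂ) * ((2 * π : ℝ) : ℂ) ^ ((m : ℂ) / 2) = 1 := by
    have h3 : ((2 * π : ℝ) : ℂ) ^ ((m : ℂ) / 2) = (((2 * π) ^ ((m : ℝ) / 2) : ℝ) : ℂ) := by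
      rw [Complex.ofReal_cpow (by positivity)]
      push_cast; rfl
    rw [h3, ← Complex.ofReal_mul, ← Real.rpow_add (by positivity)]
    simp [neg_div]
  calc _ = ((((2 * π) ^ (-(m : ℝ) / 2) : ℝ) : ℂ) * ((2 * π : ℝ) : ℂ) ^ ((m : ℂ) / 2)) *
        (((|B.det| : ℝ) : ℂ) * ((|B.det| : ℝ) : ℂ)⁻¹) *
          (Real.exp (-(1 / 2) * dotp (H.mulVec t) t) : ℝ) := by push_cast; ring
    _ = _ := by rw [h2, mul_inv_cancel₀ h1]; simp

theorem contDiff_pd {m : ℕ} {φ : (Fin m → ℝ) → ℝ} (hφ : ContDiff ℝ (⊤ : ℕ∞) φ) (j : Fin m) :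
    ContDiff ℝ (⊤ : ℕ∞) (pd φ j) :=
  (hφ.fderiv_right (m := (⊤ : ℕ∞)) (by simp)).clm_apply contDiff_const

theorem fderiv_apply_eq_dotp {m : ℕ} (f : (Fin m → ℝ) → ℝ) (x v : Fin m → ℝ) :
    fderiv ℝ f x v = dotp (gradMap f x) v := by
  conv_lhs => rw [← Finset.univ_sum_single v]
  rw [map_sum]
  refine Finset.sum_congr rfl fun i _ => ?_
  rw [gradMap, pd, mul_comm, ← smul_eq_mul, ← map_smul]
  congr 1
  ext k
  simp [Pi.single_apply]

/-- The derivative of the gradient map is multiplication by the Hessian matrix. -/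
theorem hasStrictFDerivAt_gradMap {m : ℕ} {φ : (Fin m → ℝ) → ℝ}
    (hφ : ContDiff ℝ (⊤ : ℕ∞) φ) {x : Fin m → ℝ} (hH : (hess φ x).IsHermitian) :
    HasStrictFDerivAt (gradMap φ)
      (LinearMap.toContinuousLinearMap (Matrix.toLin' (hess φ x))) x := by
  rw [hasStrictFDerivAt_pi']
  intro j
  have h := ((contDiff_pd hφ j).contDiffAt (x := x)).hasStrictFDerivAt (by simp)
  refine HasStrictFDerivAt.congr_fderiv (f := pd φ j) h ?_
  ext v
  rw [fderiv_apply_eq_dotp]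
  simp only [ContinuousLinearMap.comp_apply, ContinuousLinearMap.proj_apply,
    LinearMap.coe_toContinuousLinearMap', Matrix.toLin'_apply, Matrix.mulVec, dotProduct, dotp]
  refine Finset.sum_congr rfl fun i _ => ?_
  rw [← hH.apply j i]
  simp [hess, gradMap]

/-- An invertible matrix as a continuous linear automorphism of `ℝ^m`. -/
def matrixEquiv {m : ℕ} (A : Matrix (Fin m) (Fin m) ℝ) (hA : IsUnit A.det) :
    (Fin m → ℝ) ≃L[ℝ] (Fin m → ℝ) :=
  (Matrix.toLin'OfInv (Matrix.nonsing_inv_mul A hA)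
    (Matrix.mul_nonsing_inv A hA)).toContinuousLinearEquiv

section Legendre

variable {m : ℕ} {φ : (Fin m → ℝ) → ℝ}

theorem legInv_gradMap (hinj : Function.Injective (gradMap φ)) (x : Fin m → ℝ) :
    legInv φ (gradMap φ x) = x :=
  Function.leftInverse_invFun hinj x

theorem hasFDerivAt_legInv (hφ : ContDiff ℝ (⊤ : ℕ∞) φ) (hpos : ∀ x, (hess φ x).PosDef)
    (hinj : Function.Injective (gradMap φ)) (x : Fin m → ℝ) :
    HasFDerivAt (legInv φ)
      (LinearMap.toContinuousLinearMap (Matrix.toLin' (hess φ x)⁻¹)) (gradMap φ x) := by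
  have h : HasStrictFDerivAt (gradMap φ)
      (matrixEquiv (hess φ x) (hpos x).det_pos.ne'.isUnit : (Fin m → ℝ) →L[ℝ] (Fin m → ℝ)) x := by
    refine (hasStrictFDerivAt_gradMap hφ (hpos x).isHermitian).congr_fderiv ?_
    ext v
    simp [matrixEquiv]
  have h' := (h.to_local_left_inverse (g := legInv φ)
    (Eventually.of_forall (legInv_gradMap hinj))).hasFDerivAt
  refine h'.congr_fderiv ?_
  ext v
  simp [matrixEquiv]

theorem hasFDerivAt_sympPot (hφ : ContDiff ℝ (⊤ : ℕ∞) φ) (hpos : ∀ x, (hess φ x).PosDef)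
    (hinj : Function.Injective (gradMap φ)) (x : Fin m → ℝ) :
    HasFDerivAt (sympPot φ) (dotCLM x) (gradMap φ x) := by
  have hL := hasFDerivAt_legInv hφ hpos hinj x
  have hx := legInv_gradMap hinj x
  have hφx : HasFDerivAt φ (fderiv ℝ φ x) (legInv φ (gradMap φ x)) := by
    rw [hx]; exact (hφ.differentiable (by simp) x).hasFDerivAt
  have h1 := (hφx.comp (gradMap φ x) hL)
  have h2 := HasFDerivAt.clm_apply ((dotCLM (m := m)).hasFDerivAt (x := gradMap φ x)) hL
  have h3 := h2.sub h1
  refine (h3.congr_of_eventuallyEq (f₁ := sympPot φ) ?_).congr_fderiv ?_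
  · exact Eventually.of_forall fun y => by simp [sympPot, dotCLM_apply]
  · ext v
    simp only [hx]
    simp [fderiv_apply_eq_dotp, dotCLM_apply, dotp_comm]

theorem hess_sympPot (hφ : ContDiff ℝ (⊤ : ℕ∞) φ) (hpos : ∀ x, (hess φ x).PosDef)
    (hinj : Function.Injective (gradMap φ)) (hopen : IsOpen (Set.range (gradMap φ)))
    (x : Fin m → ℝ) :
    hess (sympPot φ) (gradMap φ x) = (hess φ x)⁻¹.transpose := by
  ext i j
  have hev : (fun y => pd (sympPot φ) j y) =ᶠ[𝓝 (gradMap φ x)] fun y => legInv φ y j := by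
    filter_upwards [hopen.mem_nhds ⟨x, rfl⟩] with y hy
    obtain ⟨z, rfl⟩ := hy
    rw [legInv_gradMap hinj, pd, (hasFDerivAt_sympPot hφ hpos hinj z).fderiv, dotCLM_apply]
    simp [dotp, Pi.single_apply]
  have hd := (hasFDerivAt_pi'.1 (hasFDerivAt_legInv hφ hpos hinj x)) j
  rw [hess, Matrix.of_apply, pd, hev.fderiv_eq, hd.fderiv]
  simp

end Legendre

section Taylor

/-- Second-order Taylor expansion with Peano remainder at a critical point. -/
theorem isLittleO_taylor_two {E : Type*} [NormedAddCommGroup E] [NormedSpace ℝ E]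
    {F : E → ℝ} {F' : E → E →L[ℝ] ℝ} {B : E →L[ℝ] E →L[ℝ] ℝ} {μ : E}
    (hB : ∀ x y, B x y = B y x) (hF : ∀ᶠ x in 𝓝 μ, HasFDerivAt F (F' x) x)
    (hF0 : F μ = 0) (hF'0 : F' μ = 0) (hF' : HasFDerivAt F' B μ) :
    (fun x => F x - 1 / 2 * B (x - μ) (x - μ)) =o[𝓝 μ] fun x => ‖x - μ‖ ^ 2 := by
  rw [Asymptotics.isLittleO_iff]
  intro ε hε
  have h1 := hF'.isLittleO.def hε
  obtain ⟨r, hr, hball⟩ := Metric.eventually_nhds_iff_ball.1 (hF.and h1)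
  filter_upwards [Metric.ball_mem_nhds μ hr] with x hx
  set R : E → ℝ := fun y => F y - 1 / 2 * B (y - μ) (y - μ) with hR
  have hsub : Metric.closedBall μ ‖x - μ‖ ⊆ Metric.ball μ r :=
    Metric.closedBall_subset_ball (by simpa [dist_eq_norm] using hx)
  have hder : ∀ y ∈ Metric.closedBall μ ‖x - μ‖,
      HasFDerivWithinAt R (F' y - B (y - μ)) (Metric.closedBall μ ‖x - μ‖) y := by
    intro y hy
    have hq : HasFDerivAt (fun y => B (y - μ) (y - μ)) ((2 : ℝ) • B (y - μ)) y := by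
      have hs : HasFDerivAt (fun y : E => y - μ) (ContinuousLinearMap.id ℝ E) y :=
        (hasFDerivAt_id y).sub_const μ
      refine ((B.hasFDerivAt.comp y hs).clm_apply hs).congr_fderiv ?_
      ext v
      have := hB v (y - μ)
      simp only [add_apply, smul_apply,
        ContinuousLinearMap.comp_apply, ContinuousLinearMap.flip_apply,
        ContinuousLinearMap.id_apply, Function.comp_apply, smul_eq_mul, this, two_mul]
    refine (((hball y (hsub hy)).1.sub (hq.const_mul (1 / 2))).congr_fderiv ?_).hasFDerivWithinAt
    ext v
    simp
  have hbd : ∀ y ∈ Metric.closedBall μ ‖x - μ‖, ‖F' y - B (y - μ)‖ ≤ ε * ‖x - μ‖ := by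
    intro y hy
    have := (hball y (hsub hy)).2
    rw [hF'0, sub_zero] at this
    refine this.trans ?_
    gcongr
    simpa [dist_eq_norm] using hy
  have h := (convex_closedBall μ ‖x - μ‖).norm_image_sub_le_of_norm_hasFDerivWithin_le hder hbd
    (Metric.mem_closedBall_self (norm_nonneg _)) (y := x) (by simp [dist_eq_norm])
  have hRμ : R μ = 0 := by simp [hR, hF0]
  rw [hRμ, sub_zero] at h
  rw [norm_pow, norm_norm, sq, ← mul_assoc]
  exact h

end Taylor

section Excess

variable {m : ℕ} {φ : (Fin m → ℝ) → ℝ}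

/-- The Legendre excess `u(x) - ⟨x, ρ⟩ + φ(ρ)`, the rate function of the Bergman weights at `ρ`. -/
def excess (φ : (Fin m → ℝ) → ℝ) (ρ x : Fin m → ℝ) : ℝ := sympPot φ x - dotp x ρ + φ ρ

/-- The quotient of the norming constant `Q_k(α)` by its leading-order asymptotics. -/
def normRatio (φ : (Fin m → ℝ) → ℝ) (k : ℕ) (α : Fin m → ℤ) : ℝ :=
  Qk φ k α * (k : ℝ) ^ ((m : ℝ) / 2) * (2 * π) ^ (-(m : ℝ) / 2)
    * Real.sqrt ((hess (sympPot φ) (lpt k α)).det) * Real.exp (-(k * sympPot φ (lpt k α)))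

theorem isLittleO_excess (hφ : ContDiff ℝ (⊤ : ℕ∞) φ) (hpos : ∀ x, (hess φ x).PosDef)
    (hinj : Function.Injective (gradMap φ)) (hopen : IsOpen (Set.range (gradMap φ)))
    (ρ : Fin m → ℝ) :
    (fun x => excess φ ρ x - 1 / 2 *
        dotp ((hess φ ρ)⁻¹.mulVec (x - gradMap φ ρ)) (x - gradMap φ ρ))
      =o[𝓝 (gradMap φ ρ)] fun x => ‖x - gradMap φ ρ‖ ^ 2 := by
  have hsymm : (hess φ ρ)⁻¹.transpose = (hess φ ρ)⁻¹ := by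
    simpa [Matrix.IsHermitian] using (hpos ρ).inv.isHermitian
  have h := isLittleO_taylor_two (F := excess φ ρ) (F' := fun x => dotCLM (legInv φ x - ρ))
    (B := dotCLM.comp (LinearMap.toContinuousLinearMap (Matrix.toLin' (hess φ ρ)⁻¹)))
    (μ := gradMap φ ρ) ?_ ?_ ?_ ?_ ?_
  · simpa [dotCLM_apply] using h
  · intro x y
    simp only [ContinuousLinearMap.comp_apply, LinearMap.coe_toContinuousLinearMap',
      Matrix.toLin'_apply, dotCLM_apply, dotp_eq_dotProduct]
    rw [dotProduct_comm, Matrix.dotProduct_mulVec, ← Matrix.mulVec_transpose, hsymm]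
  · filter_upwards [hopen.mem_nhds ⟨ρ, rfl⟩] with x hx
    obtain ⟨z, rfl⟩ := hx
    refine (((hasFDerivAt_sympPot hφ hpos hinj z).sub
      (dotCLM ρ).hasFDerivAt).add_const (φ ρ)).congr_fderiv ?_ |>.congr_of_eventuallyEq ?_
    · rw [legInv_gradMap hinj, map_sub]
    · exact Eventually.of_forall fun y => by simp [excess, dotCLM_apply, dotp_comm]
  · simp [excess, sympPot, legInv_gradMap hinj]
  · simp [legInv_gradMap hinj]
  · exact dotCLM.hasFDerivAt.comp _ ((hasFDerivAt_legInv hφ hpos hinj ρ).sub_const ρ)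

theorem exists_mul_norm_sq_le_quadratic {H : Matrix (Fin m) (Fin m) ℝ} (hH : H.PosDef) :
    ∃ c > 0, ∀ y : Fin m → ℝ, c * ‖y‖ ^ 2 ≤ dotp (H⁻¹.mulVec y) y := by
  obtain ⟨B, hB, hHB⟩ := exists_quadratic_factorization hH
  have hu : IsUnit B.det := isUnit_iff_ne_zero.2 hB
  set D := LinearMap.toContinuousLinearMap (Matrix.toLin' B⁻¹) with hD
  refine ⟨1 / (‖D‖ ^ 2 + 1), by positivity, fun y => ?_⟩
  have hq : dotp (H⁻¹.mulVec y) y = ∑ i, (B.mulVec y) i ^ 2 := by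
    rw [dotp_eq_dotProduct, hHB, ← Matrix.mulVec_mulVec, Matrix.mulVec_transpose,
      ← Matrix.dotProduct_mulVec]
    simp [dotProduct, sq]
  have hq0 : 0 ≤ dotp (H⁻¹.mulVec y) y := by
    rw [hq]; positivity
  have h1 : ‖B.mulVec y‖ ≤ Real.sqrt (dotp (H⁻¹.mulVec y) y) := by
    refine (pi_norm_le_iff_of_nonneg (Real.sqrt_nonneg _)).2 fun i => ?_
    rw [hq, Real.norm_eq_abs]
    exact Real.abs_le_sqrt (Finset.single_le_sum (f := fun i => (B.mulVec y) i ^ 2)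
      (fun j _ => sq_nonneg _) (Finset.mem_univ i))
  have h2 : ‖y‖ ≤ ‖D‖ * ‖B.mulVec y‖ := by
    have : D (B.mulVec y) = y := by
      simp [hD, Matrix.mulVec_mulVec, Matrix.nonsing_inv_mul _ hu]
    calc ‖y‖ = ‖D (B.mulVec y)‖ := by rw [this]
      _ ≤ _ := D.le_opNorm _
  have h4 : ‖y‖ ≤ ‖D‖ * Real.sqrt (dotp (H⁻¹.mulVec y) y) := h2.trans (by gcongr)
  have h3 : ‖y‖ ^ 2 ≤ ‖D‖ ^ 2 * dotp (H⁻¹.mulVec y) y := by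
    calc ‖y‖ ^ 2 ≤ (‖D‖ * Real.sqrt (dotp (H⁻¹.mulVec y) y)) ^ 2 := by gcongr
      _ = _ := by rw [mul_pow, Real.sq_sqrt hq0]
  rw [div_mul_eq_mul_div, one_mul, div_le_iff₀ (by positivity)]
  linarith

theorem eventually_mul_norm_sq_le_excess (hφ : ContDiff ℝ (⊤ : ℕ∞) φ)
    (hpos : ∀ x, (hess φ x).PosDef) (hinj : Function.Injective (gradMap φ))
    (hopen : IsOpen (Set.range (gradMap φ))) (ρ : Fin m → ℝ) :
    ∃ c > 0, ∀ᶠ x in 𝓝 (gradMap φ ρ), c * ‖x - gradMap φ ρ‖ ^ 2 ≤ excess φ ρ x := by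
  obtain ⟨c, hc, hq⟩ := exists_mul_norm_sq_le_quadratic (hpos ρ)
  refine ⟨c / 4, by positivity, ?_⟩
  filter_upwards [(isLittleO_excess hφ hpos hinj hopen ρ).def (by positivity : 0 < c / 4)]
    with x hx
  rw [norm_pow, norm_norm] at hx
  have h1 := neg_le_of_abs_le hx
  have h2 := hq (x - gradMap φ ρ)
  linarith

theorem continuous_dotp_mulVec (A : Matrix (Fin m) (Fin m) ℝ) :
    Continuous fun y : Fin m → ℝ => dotp (A.mulVec y) y := by
  unfold dotp Matrix.mulVec dotProduct
  fun_prop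

theorem tendsto_mul_excess (hφ : ContDiff ℝ (⊤ : ℕ∞) φ)
    (hpos : ∀ x, (hess φ x).PosDef) (hinj : Function.Injective (gradMap φ))
    (hopen : IsOpen (Set.range (gradMap φ))) (ρ : Fin m → ℝ)
    {x : ℕ → Fin m → ℝ} {y : Fin m → ℝ} (hx : Tendsto x atTop (𝓝 (gradMap φ ρ)))
    (hy : Tendsto (fun k : ℕ => Real.sqrt k • (x k - gradMap φ ρ)) atTop (𝓝 y)) :
    Tendsto (fun k : ℕ => (k : ℝ) * excess φ ρ (x k)) atTop
      (𝓝 (1 / 2 * dotp ((hess φ ρ)⁻¹.mulVec y) y)) := by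
  have hk : ∀ k : ℕ, (k : ℝ) = Real.sqrt k ^ 2 := fun k => (Real.sq_sqrt k.cast_nonneg).symm
  have h1 := (isLittleO_excess hφ hpos hinj hopen ρ).comp_tendsto hx
  have h2 := (Asymptotics.isBigO_refl (fun k : ℕ => (k : ℝ)) atTop).mul_isLittleO h1
  have h3 : (fun k : ℕ => (k : ℝ) * ‖x k - gradMap φ ρ‖ ^ 2) =O[atTop] fun _ => (1 : ℝ) := by
    refine (((hy.norm).pow 2).congr fun k => ?_).isBigO_one ℝ
    rw [norm_smul, mul_pow, Real.norm_of_nonneg (Real.sqrt_nonneg _), ← hk]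
  have h4 := (Asymptotics.isLittleO_one_iff ℝ).1 (h2.trans_isBigO h3)
  have h5 := (((continuous_dotp_mulVec (hess φ ρ)⁻¹).tendsto y).comp hy).const_mul (1 / 2)
  have h6 := h4.add h5
  rw [zero_add] at h6
  refine h6.congr fun k => ?_
  have : dotp ((hess φ ρ)⁻¹.mulVec (Real.sqrt k • (x k - gradMap φ ρ)))
      (Real.sqrt k • (x k - gradMap φ ρ)) =
      k * dotp ((hess φ ρ)⁻¹.mulVec (x k - gradMap φ ρ)) (x k - gradMap φ ρ) := by
    rw [Matrix.mulVec_smul]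
    simp only [dotp_eq_dotProduct, smul_dotProduct, dotProduct_smul, smul_eq_mul]
    rw [← mul_assoc, ← sq, ← hk]
  simp only [Function.comp_apply, this]
  ring

theorem continuous_hess (hφ : ContDiff ℝ (⊤ : ℕ∞) φ) : Continuous (hess φ) :=
  continuous_matrix fun i j => (contDiff_pd (contDiff_pd hφ j) i).continuous

theorem det_hess_sympPot (hφ : ContDiff ℝ (⊤ : ℕ∞) φ) (hpos : ∀ x, (hess φ x).PosDef)
    (hinj : Function.Injective (gradMap φ)) (hopen : IsOpen (Set.range (gradMap φ)))
    (x : Fin m → ℝ) :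
    (hess (sympPot φ) (gradMap φ x)).det = ((hess φ x).det)⁻¹ := by
  rw [hess_sympPot hφ hpos hinj hopen, Matrix.det_transpose, Matrix.det_nonsing_inv,
    Ring.inverse_eq_inv']

theorem tendsto_det_hess_sympPot (hφ : ContDiff ℝ (⊤ : ℕ∞) φ) (hpos : ∀ x, (hess φ x).PosDef)
    (hinj : Function.Injective (gradMap φ)) (hopen : IsOpen (Set.range (gradMap φ)))
    (ρ : Fin m → ℝ) :
    Tendsto (fun x => (hess (sympPot φ) x).det) (𝓝 (gradMap φ ρ)) (𝓝 ((hess φ ρ).det)⁻¹) := by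
  have h1 : Tendsto (legInv φ) (𝓝 (gradMap φ ρ)) (𝓝 ρ) := by
    have := (hasFDerivAt_legInv hφ hpos hinj ρ).continuousAt
    rwa [ContinuousAt, legInv_gradMap hinj] at this
  have h2 := (((continuous_hess hφ).matrix_det.tendsto ρ).comp h1).inv₀ (hpos ρ).det_pos.ne'
  refine h2.congr' ?_
  filter_upwards [hopen.mem_nhds ⟨ρ, rfl⟩] with x hx
  obtain ⟨z, rfl⟩ := hx
  simp [det_hess_sympPot hφ hpos hinj hopen, legInv_gradMap hinj]

theorem wt_eq_of_normRatio_ne_zero {P : Set (Fin m → ℝ)} {k : ℕ} (hk : 1 ≤ k) {α : Fin m → ℤ}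
    (hα : lpt k α ∈ P) (hr : normRatio φ k α ≠ 0) (ρ : Fin m → ℝ) :
    (Real.sqrt k ^ m)⁻¹ * wt P φ k α ρ =
      (2 * π) ^ (-(m : ℝ) / 2) * Real.sqrt ((hess (sympPot φ) (lpt k α)).det) *
        Real.exp (-(k * excess φ ρ (lpt k α))) / normRatio φ k α := by
  have hk0 : (k : ℝ) ≠ 0 := by positivity
  have hpow : (k : ℝ) ^ ((m : ℝ) / 2) = Real.sqrt k ^ m := by
    rw [Real.rpow_div_two_eq_sqrt _ k.cast_nonneg, Real.rpow_natCast]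
  have hdot : dotp (fun i => (α i : ℝ)) ρ = k * dotp (lpt k α) ρ := by
    simp only [dotp, lpt, Finset.mul_sum]
    exact Finset.sum_congr rfl fun i _ => by field_simp
  have hexp : Real.exp (-(k * excess φ ρ (lpt k α))) =
      Real.exp (dotp (fun i => (α i : ℝ)) ρ - k * φ ρ) *
        Real.exp (-(k * sympPot φ (lpt k α))) := by
    rw [← Real.exp_add, hdot, excess]
    congr 1; ring
  rw [normRatio] at hr ⊢
  simp only [mul_ne_zero_iff] at hr
  obtain ⟨⟨⟨⟨hQ, hkm⟩, hpi⟩, hS⟩, hE⟩ := hr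
  rw [hpow] at hkm ⊢
  rw [wt, if_pos hα, hexp]
  field_simp

end Excess

section Weights

variable {m : ℕ}

theorem abs_le_enorm' (x : Fin m → ℝ) (i : Fin m) : |x i| ≤ enorm' x :=
  Real.abs_le_sqrt (Finset.single_le_sum (f := fun i => x i ^ 2)
    (fun _ _ => sq_nonneg _) (Finset.mem_univ i))

theorem norm_le_enorm' (x : Fin m → ℝ) : ‖x‖ ≤ enorm' x :=
  (pi_norm_le_iff_of_nonneg (Real.sqrt_nonneg _)).2 fun i => abs_le_enorm' x i

theorem continuous_enorm' : Continuous (enorm' (m := m)) := by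
  unfold enorm'
  fun_prop

theorem finite_setOf_lpt_mem {P : Set (Fin m → ℝ)} (hP : IsCompact P) {k : ℕ} (hk : 1 ≤ k) :
    {α : Fin m → ℤ | lpt k α ∈ P}.Finite := by
  obtain ⟨R, hR⟩ := hP.isBounded.exists_norm_le
  have hk0 : (0 : ℝ) < k := by positivity
  refine (Set.finite_Icc (fun _ : Fin m => -⌈R * k⌉) (fun _ => ⌈R * k⌉)).subset fun α hα => ?_
  have h : ∀ i, |(α i : ℝ)| ≤ ⌈R * k⌉ := by
    intro i
    have h1 := (norm_le_pi_norm (lpt k α) i).trans (hR _ hα)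
    rw [lpt, Real.norm_eq_abs, abs_div, abs_of_pos hk0, div_le_iff₀ hk0] at h1
    exact h1.trans (Int.le_ceil _)
  refine ⟨fun i => ?_, fun i => ?_⟩
  · have := neg_le_of_abs_le (h i)
    exact_mod_cast this
  · have := le_of_abs_le (h i)
    exact_mod_cast this

theorem wt_nonneg {P : Set (Fin m → ℝ)} {φ : (Fin m → ℝ) → ℝ} (hpos : ∀ x, (hess φ x).PosDef)
    (k : ℕ) (α : Fin m → ℤ) (ρ : Fin m → ℝ) : 0 ≤ wt P φ k α ρ := by
  rw [wt]
  split_ifs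
  · exact div_nonneg (Real.exp_pos _).le
      (integral_nonneg fun x => mul_nonneg (Real.exp_pos _).le (hpos x).det_pos.le)
  · exact le_rfl

theorem summable_of_forall_wt_eq_zero {E : Type*} [AddCommMonoid E] [TopologicalSpace E]
    {P : Set (Fin m → ℝ)} (hP : IsCompact P) {φ : (Fin m → ℝ) → ℝ} {k : ℕ} (hk : 1 ≤ k)
    {ρ : Fin m → ℝ} {f : (Fin m → ℤ) → E} (hf : ∀ α, wt P φ k α ρ = 0 → f α = 0) :
    Summable f :=
  summable_of_hasFiniteSupport <| (finite_setOf_lpt_mem hP hk).subset fun α hα => by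
    by_contra h
    exact hα (hf α (if_neg h))

/-- The lattice point of `ℤ^m` whose rescaling `√k (α/k - μ)` is closest to `y` from below. -/
def scaledFloor (k : ℕ) (μ y : Fin m → ℝ) : Fin m → ℤ :=
  fun i => ⌊Real.sqrt k * y i + k * μ i⌋

theorem norm_smul_lpt_scaledFloor_sub_le {k : ℕ} (hk : 1 ≤ k) (μ y : Fin m → ℝ) :
    ‖Real.sqrt k • (lpt k (scaledFloor k μ y) - μ) - y‖ ≤ (Real.sqrt k)⁻¹ := by
  have hk0 : (0 : ℝ) < k := by positivity
  have hs : 0 < Real.sqrt k := Real.sqrt_pos.2 hk0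
  refine (pi_norm_le_iff_of_nonneg (by positivity)).2 fun i => ?_
  have h1 := Int.floor_le (Real.sqrt k * y i + k * μ i)
  have h2 := Int.lt_floor_add_one (Real.sqrt k * y i + k * μ i)
  have h3 : (Real.sqrt k • (lpt k (scaledFloor k μ y) - μ) - y) i =
      ((⌊Real.sqrt k * y i + k * μ i⌋ : ℝ) - (Real.sqrt k * y i + k * μ i)) * (Real.sqrt k)⁻¹ := by
    simp only [Pi.sub_apply, Pi.smul_apply, lpt, scaledFloor, smul_eq_mul]
    generalize (⌊Real.sqrt k * y i + k * μ i⌋ : ℝ) = a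
    have hsq : (k : ℝ) = Real.sqrt k * Real.sqrt k := (Real.mul_self_sqrt hk0.le).symm
    generalize Real.sqrt k = s at *
    rw [hsq]
    field_simp
    ring
  rw [h3, Real.norm_eq_abs, abs_mul, abs_of_pos (inv_pos.2 hs)]
  refine mul_le_of_le_one_left (by positivity) (abs_le.2 ⟨by linarith, by linarith⟩)

theorem tendsto_inv_sqrt_natCast : Tendsto (fun k : ℕ => (Real.sqrt k)⁻¹) atTop (𝓝 0) :=
  (Real.tendsto_sqrt_atTop.comp tendsto_natCast_atTop_atTop).inv_tendsto_atTop

theorem tendsto_smul_lpt_scaledFloor_sub (μ y : Fin m → ℝ) :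
    Tendsto (fun k : ℕ => Real.sqrt k • (lpt k (scaledFloor k μ y) - μ)) atTop (𝓝 y) := by
  rw [tendsto_iff_norm_sub_tendsto_zero]
  refine squeeze_zero' (Eventually.of_forall fun _ => norm_nonneg _) ?_ tendsto_inv_sqrt_natCast
  filter_upwards [eventually_ge_atTop 1] with k hk
  exact norm_smul_lpt_scaledFloor_sub_le hk μ y

theorem tendsto_lpt_scaledFloor (μ y : Fin m → ℝ) :
    Tendsto (fun k : ℕ => lpt k (scaledFloor k μ y)) atTop (𝓝 μ) := by
  have h := (tendsto_inv_sqrt_natCast.smul (tendsto_smul_lpt_scaledFloor_sub μ y)).add_const μ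
  rw [zero_smul, zero_add] at h
  refine h.congr' ?_
  filter_upwards [eventually_ge_atTop 1] with k hk
  have hs : Real.sqrt k ≠ 0 := (Real.sqrt_pos.2 (by positivity)).ne'
  rw [smul_smul, inv_mul_cancel₀ hs, one_smul, sub_add_cancel]

theorem integrable_exp_neg_mul_sum_sq {b : ℝ} (hb : 0 < b) :
    Integrable fun y : Fin m → ℝ => Real.exp (-(b * ∑ i, y i ^ 2)) := by
  have h := (GaussianFourier.integrable_cexp_neg_mul_sum_add (b := (b : ℂ)) (ι := Fin m)
    (by simpa using hb) 0).norm
  refine h.congr (Eventually.of_forall fun y => ?_)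
  simp only [Pi.zero_apply, zero_mul, Finset.sum_const_zero, add_zero]
  rw [Complex.norm_exp]
  congr 1
  have : (-(b : ℂ) * ∑ i, (y i : ℂ) ^ 2) = ((-(b * ∑ i, y i ^ 2) : ℝ) : ℂ) := by push_cast; ring
  rw [this, Complex.ofReal_re]

theorem sum_sq_le_mul_norm_sq (y : Fin m → ℝ) : ∑ i, y i ^ 2 ≤ (m + 1) * ‖y‖ ^ 2 := by
  calc ∑ i, y i ^ 2 ≤ ∑ _i : Fin m, ‖y‖ ^ 2 := Finset.sum_le_sum fun i _ => by
        rw [← sq_abs]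
        gcongr
        exact norm_le_pi_norm y i
    _ = m * ‖y‖ ^ 2 := by simp
    _ ≤ _ := by nlinarith [sq_nonneg ‖y‖]

end Weights

/-- The contribution to `k^{-m}` times the characteristic sum of the lattice points close to the
moment image of `ρ` converges to the Gaussian characteristic function. -/
theorem exists_tendsto_localized_sum {m : ℕ}
    {P : Set (Fin m → ℝ)} (hPcpt : IsCompact P)
    {φ : (Fin m → ℝ) → ℝ} (hφ : ContDiff ℝ (⊤ : ℕ∞) φ)
    (hpos : ∀ ρ : Fin m → ℝ, (hess φ ρ).PosDef)
    (hφbij : Set.BijOn (gradMap φ) Set.univ (interior P))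
    (hQQ : ∀ K : Set (Fin m → ℝ), IsCompact K → K ⊆ interior P →
      ∃ C > 0, ∀ k : ℕ, 1 ≤ k → ∀ α : Fin m → ℤ, lpt k α ∈ K →
        |normRatio φ k α - 1| ≤ C / k)
    (ρ t : Fin m → ℝ) :
    ∃ δ > 0, Tendsto (fun k : ℕ => ((k : ℂ) ^ m)⁻¹ * ∑' α : Fin m → ℤ,
        (if δ ≤ enorm' (lpt k α - gradMap φ ρ) then 0 else (wt P φ k α ρ : ℂ)) *
          Complex.exp (Complex.I *
            ((dotp t (Real.sqrt k • (lpt k α - gradMap φ ρ)) : ℝ) : ℂ)))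
      atTop (𝓝 ((Real.exp (-(1 / 2) * dotp ((hess φ ρ).mulVec t) t) : ℝ) : ℂ)) := by
  have hinj : Function.Injective (gradMap φ) := Set.injOn_univ.1 hφbij.injOn
  have hrange : Set.range (gradMap φ) = interior P := by rw [← Set.image_univ, hφbij.image_eq]
  have hopen : IsOpen (Set.range (gradMap φ)) := hrange ▸ isOpen_interior
  set μ := gradMap φ ρ with hμ
  set S : (Fin m → ℝ) → ℝ := fun x => Real.sqrt ((hess (sympPot φ) x).det) with hS
  set S₀ : ℝ := Real.sqrt ((hess φ ρ).det)⁻¹ with hS₀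
  set A : ℝ := (2 * π) ^ (-(m : ℝ) / 2) with hA
  have hA0 : 0 ≤ A := by positivity
  have hSlim : Tendsto S (𝓝 μ) (𝓝 S₀) := (tendsto_det_hess_sympPot hφ hpos hinj hopen ρ).sqrt
  obtain ⟨c, hc, hcF⟩ := eventually_mul_norm_sq_le_excess hφ hpos hinj hopen ρ
  have hPmem : ∀ᶠ x in 𝓝 μ, x ∈ interior P :=
    isOpen_interior.mem_nhds (hrange ▸ Set.mem_range_self ρ)
  have hSle : ∀ᶠ x in 𝓝 μ, S x ≤ S₀ + 1 :=
    (hSlim.eventually_lt_const (lt_add_one S₀)).mono fun _ h => h.le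
  obtain ⟨δ, hδ, hball⟩ := Metric.nhds_basis_closedBall.eventually_iff.1
    (hcF.and (hPmem.and hSle))
  obtain ⟨C, hC, hratio⟩ := hQQ (Metric.closedBall μ δ) (isCompact_closedBall _ _)
    fun x hx => (hball hx).2.1
  have hnear : ∀ x : Fin m → ℝ, ¬ δ ≤ enorm' (x - μ) → x ∈ Metric.closedBall μ δ := by
    intro x hx
    rw [Metric.mem_closedBall, dist_eq_norm]
    exact (norm_le_enorm' _).trans (not_le.1 hx).le
  refine ⟨δ, hδ, ?_⟩
  set g : ℕ → (Fin m → ℤ) → ℂ := fun k α =>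
    (if δ ≤ enorm' (lpt k α - μ) then 0 else (((Real.sqrt k ^ m)⁻¹ * wt P φ k α ρ : ℝ) : ℂ)) *
      Complex.exp (Complex.I * ((dotp t (Real.sqrt k • (lpt k α - μ)) : ℝ) : ℂ)) with hg
  have hhalf : ∀ᶠ k : ℕ in atTop, 1 ≤ k ∧ C / k ≤ 1 / 2 :=
    (eventually_ge_atTop 1).and
      ((tendsto_const_div_atTop_nhds_zero_nat C).eventually_le_const (by norm_num))
  have hwt : ∀ k : ℕ, 1 ≤ k → C / k ≤ 1 / 2 → ∀ α, lpt k α ∈ Metric.closedBall μ δ →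
      1 / 2 ≤ normRatio φ k α ∧ (Real.sqrt k ^ m)⁻¹ * wt P φ k α ρ =
        A * S (lpt k α) * Real.exp (-(k * excess φ ρ (lpt k α))) / normRatio φ k α := by
    intro k hk hCk α hα
    have h1 := neg_le_of_abs_le (hratio k hk α hα)
    have h2 : 1 / 2 ≤ normRatio φ k α := by linarith
    exact ⟨h2, wt_eq_of_normRatio_ne_zero hk (interior_subset (hball hα).2.1)
      (by linarith : (0 : ℝ) < normRatio φ k α).ne' ρ⟩
  have hlim : Tendsto (fun k : ℕ => ∫ y, g k (scaledFloor k μ y)) atTop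
      (𝓝 (∫ y : Fin m → ℝ, ((A * S₀ *
        Real.exp (-(1 / 2 * dotp ((hess φ ρ)⁻¹.mulVec y) y)) : ℝ) : ℂ) *
          Complex.exp (Complex.I * (dotp t y : ℝ)))) := by
    refine tendsto_integral_filter_of_dominated_convergence
      (fun y => A * (S₀ + 1) * Real.exp c * 2 *
        Real.exp (-(c / (2 * (m + 1)) * ∑ i, y i ^ 2))) ?_ ?_ ?_ ?_
    · refine Eventually.of_forall fun k => Measurable.aestronglyMeasurable ?_
      refine (measurable_of_countable (g k)).comp
        (measurable_pi_lambda _ fun i => Int.measurable_floor.comp ?_)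
      fun_prop
    · filter_upwards [hhalf] with k hk
      refine Eventually.of_forall fun y => ?_
      have hnn : 0 ≤ A * (S₀ + 1) * Real.exp c * 2 := by positivity
      simp only [hg]
      rw [norm_mul, mul_comm Complex.I, Complex.norm_exp_ofReal_mul_I, mul_one]
      split_ifs with hfar
      · rw [norm_zero]; positivity
      set α := scaledFloor k μ y with hα
      have hα' := hnear _ hfar
      obtain ⟨hr, hw⟩ := hwt k hk.1 hk.2 α hα'
      obtain ⟨hcx, -, hSx⟩ := hball hα'
      have hr0 : 0 < normRatio φ k α := by linarith
      rw [Complex.norm_real, hw, Real.norm_of_nonneg (by positivity)]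
      have hY : ‖y‖ ≤ Real.sqrt k * ‖lpt k α - μ‖ + 1 := by
        have h1 := norm_smul_lpt_scaledFloor_sub_le hk.1 μ y
        rw [norm_sub_rev] at h1
        have h2 : (Real.sqrt k)⁻¹ ≤ 1 :=
          inv_le_one_of_one_le₀ (Real.one_le_sqrt.2 (by exact_mod_cast hk.1))
        have h3 := norm_sub_norm_le y (Real.sqrt k • (lpt k α - μ))
        rw [norm_smul, Real.norm_of_nonneg (Real.sqrt_nonneg _)] at h3
        linarith
      have hexp : -(k * excess φ ρ (lpt k α)) ≤ c + -(c / (2 * (m + 1)) * ∑ i, y i ^ 2) := by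
        have h1 : (k : ℝ) * (c * ‖lpt k α - μ‖ ^ 2) ≤ k * excess φ ρ (lpt k α) := by gcongr
        have h2 : (k : ℝ) * (c * ‖lpt k α - μ‖ ^ 2) = c * (Real.sqrt k * ‖lpt k α - μ‖) ^ 2 := by
          rw [mul_pow, Real.sq_sqrt k.cast_nonneg]; ring
        have h3 : ‖y‖ ^ 2 ≤ 2 * (Real.sqrt k * ‖lpt k α - μ‖) ^ 2 + 2 := by
          nlinarith [norm_nonneg y, sq_nonneg (Real.sqrt k * ‖lpt k α - μ‖ - 1)]
        have h4 : c / (2 * (m + 1)) * ∑ i, y i ^ 2 ≤ c / (2 * (m + 1)) * ((m + 1) * ‖y‖ ^ 2) := by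
          gcongr
          exact sum_sq_le_mul_norm_sq y
        have h5 : c / (2 * ((m : ℝ) + 1)) * ((m + 1) * ‖y‖ ^ 2) = c / 2 * ‖y‖ ^ 2 := by
          field_simp
        nlinarith
      calc A * S (lpt k α) * Real.exp (-(k * excess φ ρ (lpt k α))) / normRatio φ k α
          ≤ A * (S₀ + 1) * Real.exp (c + -(c / (2 * (m + 1)) * ∑ i, y i ^ 2)) / (1 / 2) := by
            gcongr
        _ = _ := by rw [Real.exp_add]; ring
    · exact (integrable_exp_neg_mul_sum_sq (by positivity)).const_mul _
    · refine Eventually.of_forall fun y => ?_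
      have hx := tendsto_lpt_scaledFloor μ y
      have hY := tendsto_smul_lpt_scaledFloor_sub μ y
      have hclose : ∀ᶠ k : ℕ in atTop, ¬ δ ≤ enorm' (lpt k (scaledFloor k μ y) - μ) := by
        have h := (continuous_enorm'.tendsto (0 : Fin m → ℝ)).comp
          ((sub_self μ) ▸ hx.sub_const μ)
        have h0 : enorm' (0 : Fin m → ℝ) = 0 := by simp [enorm']
        rw [h0] at h
        exact (h.eventually_lt_const hδ).mono fun k hk => not_le.2 hk
      have hrlim : Tendsto (fun k : ℕ => normRatio φ k (scaledFloor k μ y)) atTop (𝓝 1) := by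
        rw [tendsto_iff_norm_sub_tendsto_zero]
        refine squeeze_zero' (Eventually.of_forall fun _ => norm_nonneg _) ?_
          (tendsto_const_div_atTop_nhds_zero_nat C)
        filter_upwards [hclose, eventually_ge_atTop 1] with k hk hk1
        exact hratio k hk1 _ (hnear _ hk)
      have hreal := (((hSlim.comp hx).const_mul A).mul
        ((Real.continuous_exp.tendsto _).comp
          (tendsto_mul_excess hφ hpos hinj hopen ρ hx hY).neg)).div hrlim one_ne_zero
      rw [div_one] at hreal
      have hchar : Tendsto (fun k : ℕ => Complex.exp (Complex.I *
          ((dotp t (Real.sqrt k • (lpt k (scaledFloor k μ y) - μ)) : ℝ) : ℂ))) atTop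
          (𝓝 (Complex.exp (Complex.I * (dotp t y : ℝ)))) := by
        have hcont : Continuous fun v : Fin m → ℝ => Complex.exp (Complex.I * (dotp t v : ℝ)) := by
          unfold dotp
          fun_prop
        exact (hcont.tendsto y).comp hY
      refine (((Complex.continuous_ofReal.tendsto _).comp hreal).mul hchar).congr' ?_
      filter_upwards [hclose, hhalf] with k hk hk'
      simp only [hg, if_neg hk, (hwt k hk'.1 hk'.2 _ (hnear _ hk)).2, Function.comp_apply]
      rfl
  rw [integral_gaussian_quadratic (hpos ρ) t] at hlim
  refine hlim.congr' ?_
  filter_upwards [eventually_ge_atTop 1] with k hk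
  have hk0 : (0 : ℝ) < k := by positivity
  have hfin : (g k).support.Finite := (finite_setOf_lpt_mem hPcpt hk).subset fun α hα => by
    by_contra h
    exact hα (by simp [hg, wt, show lpt k α ∉ P from h])
  rw [show (∫ y, g k (scaledFloor k μ y)) = _ from
    integral_floor_eq_tsum (Real.sqrt_pos.2 hk0) (fun i => k * μ i) (g k) hfin,
    ← tsum_mul_left, ← tsum_mul_left]
  refine tsum_congr fun α => ?_
  have hkc : (k : ℂ) ^ m = ((Real.sqrt k : ℝ) : ℂ) ^ m * ((Real.sqrt k : ℝ) : ℂ) ^ m := by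
    rw [← mul_pow, ← Complex.ofReal_mul, Real.mul_self_sqrt hk0.le, Complex.ofReal_natCast]
  rw [hkc, mul_inv]
  simp only [hg]
  split_ifs
  · simp
  · push_cast
    ring

/-- pointwise convergence of the characteristic functions of the
centered, `√k`-dilated Bergman measures to the Gaussian characteristic function. -/
theorem char_fn_convergence {m : ℕ}
    (P : Set (Fin m → ℝ)) (hPcpt : IsCompact P) (hPconv : Convex ℝ P)
    (hPint : (interior P).Nonempty)
    (φ : (Fin m → ℝ) → ℝ) (hφ : ContDiff ℝ (⊤ : ℕ∞) φ)
    (hφpos : ∀ ρ : Fin m → ℝ, (hess φ ρ).PosDef)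
    (hφbij : Set.BijOn (gradMap φ) Set.univ (interior P))
    (ρ : Fin m → ℝ)
    (hQQ : ∀ K : Set (Fin m → ℝ), IsCompact K → K ⊆ interior P →
      ∃ C > 0, ∀ k : ℕ, 1 ≤ k → ∀ α : Fin m → ℤ, lpt k α ∈ K →
        |Qk φ k α * (k : ℝ) ^ ((m : ℝ) / 2) * (2 * π) ^ (-(m : ℝ) / 2)
            * Real.sqrt ((hess (sympPot φ) (lpt k α)).det)
            * Real.exp (-(k * sympPot φ (lpt k α))) - 1| ≤ C / k)
    (hdos : ∃ C > 0, ∀ k : ℕ, 1 ≤ k → |dos P φ k ρ * ((k : ℝ) ^ m)⁻¹ - 1| ≤ C / k)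
    (hloc : ∀ δ > 0,
      Tendsto (fun k : ℕ => (dos P φ k ρ)⁻¹ *
          ∑' α : Fin m → ℤ,
            if δ ≤ enorm' (lpt k α - gradMap φ ρ) then wt P φ k α ρ else 0)
        atTop (𝓝 0)) :
    ∀ t : Fin m → ℝ,
      Tendsto (fun k : ℕ =>
          ((dos P φ k ρ : ℝ) : ℂ)⁻¹ *
            ∑' α : Fin m → ℤ, (wt P φ k α ρ : ℂ) *
              Complex.exp (Complex.I *
                ((dotp t (Real.sqrt k • (lpt k α - gradMap φ ρ)) : ℝ) : ℂ)))
        atTop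
        (𝓝 ((Real.exp (-(1 / 2) * dotp ((hess φ ρ).mulVec t) t) : ℝ) : ℂ)) := by
  intro t
  obtain ⟨δ, hδ, hnear⟩ :=
    exists_tendsto_localized_sum hPcpt hφ hφpos hφbij hQQ ρ t
  have hdos1 : Tendsto (fun k : ℕ => dos P φ k ρ * ((k : ℝ) ^ m)⁻¹) atTop (𝓝 1) := by
    obtain ⟨C, -, hC⟩ := hdos
    rw [tendsto_iff_norm_sub_tendsto_zero]
    refine squeeze_zero' (Eventually.of_forall fun _ => norm_nonneg _) ?_
      (tendsto_const_div_atTop_nhds_zero_nat C)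
    filter_upwards [eventually_ge_atTop 1] with k hk using hC k hk
  have hmain := (((Complex.continuous_ofReal.tendsto _).comp hdos1).inv₀ (by simp)).mul hnear
  have hfar : Tendsto (fun k : ℕ => ((dos P φ k ρ : ℝ) : ℂ)⁻¹ * ∑' α : Fin m → ℤ,
      (if δ ≤ enorm' (lpt k α - gradMap φ ρ) then (wt P φ k α ρ : ℂ) else 0) *
        Complex.exp (Complex.I *
          ((dotp t (Real.sqrt k • (lpt k α - gradMap φ ρ)) : ℝ) : ℂ))) atTop (𝓝 0) := by
    refine squeeze_zero_norm' ?_ (hloc δ hδ)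
    filter_upwards [eventually_ge_atTop 1] with k hk
    have hdos0 : 0 ≤ dos P φ k ρ := tsum_nonneg fun α => wt_nonneg hφpos k α ρ
    rw [norm_mul, norm_inv, Complex.norm_real, Real.norm_of_nonneg hdos0]
    gcongr
    have hterm : ∀ α : Fin m → ℤ,
        ‖(if δ ≤ enorm' (lpt k α - gradMap φ ρ) then (wt P φ k α ρ : ℂ) else 0) *
          Complex.exp (Complex.I *
            ((dotp t (Real.sqrt k • (lpt k α - gradMap φ ρ)) : ℝ) : ℂ))‖ =
        if δ ≤ enorm' (lpt k α - gradMap φ ρ) then wt P φ k α ρ else 0 := by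
      intro α
      rw [norm_mul, mul_comm Complex.I, Complex.norm_exp_ofReal_mul_I, mul_one]
      split_ifs
      · rw [Complex.norm_real, Real.norm_of_nonneg (wt_nonneg hφpos k α ρ)]
      · exact norm_zero
    simp_rw [← hterm]
    refine norm_tsum_le_tsum_norm (summable_of_forall_wt_eq_zero hPcpt (φ := φ) hk (ρ := ρ) ?_)
    intro α hα
    simp [hα]
  have hsum := hmain.add hfar
  simp only [Complex.ofReal_one, inv_one, one_mul, add_zero] at hsum
  refine hsum.congr' ?_
  filter_upwards [eventually_ge_atTop 1] with k hk
  have hkm : ((k : ℂ) ^ m) ≠ 0 := pow_ne_zero _ (by exact_mod_cast (by lia : k ≠ 0))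
  simp only [Function.comp_apply, Complex.ofReal_mul, Complex.ofReal_inv, Complex.ofReal_pow,
    Complex.ofReal_natCast, mul_inv, inv_inv]
  rw [mul_assoc, ← mul_assoc ((k : ℂ) ^ m), mul_inv_cancel₀ hkm, one_mul, ← mul_add,
    ← Summable.tsum_add]
  · congr 1
    refine tsum_congr fun α => ?_
    rw [← add_mul]
    split_ifs <;> simp
  · exact summable_of_forall_wt_eq_zero hPcpt (φ := φ) hk (ρ := ρ) fun α hα => by simp [hα]
  · exact summable_of_forall_wt_eq_zero hPcpt (φ := φ) hk (ρ := ρ) fun α hα => by simp [hα]
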